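/- The Scenario-1 coverage service function on trajectories is not submodular: there exist a threshold ψ > 0, a finite set U of users, each user u having a source point s(u) and a destination point d(u) in the Euclidean plane ℝ², finite collections of facilities A ⊆ B (each facility being a finite set of points of ℝ²), and an additional facility x, such that SO(U, B ∪ {x}) − SO(U, B) > SO(U, A ∪ {x}) − SO(U, A), where SO(U, F) denotes the number of users u ∈ U such that some point of ⋃F lies within Euclidean distance ψ of s(u) and some point of ⋃F lies within Euclidean distance ψ of d(u). In particular SO violates the submodularity inequality g(A ∪ {x}) − g(A) ≥ g(B ∪ {x}) − g(B). -/

import Mathlib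

/-- Scenario-1 coverage service function: the number of users `u : U` such that
some point of `⋃₀ F` is within Euclidean distance `ψ` of the source `s u` and
some point of `⋃₀ F` is within Euclidean distance `ψ` of the destination `d u`. -/
noncomputable def SO (ψ : ℝ) {U : Type} (s d : U → EuclideanSpace ℝ (Fin 2))
    (F : Set (Set (EuclideanSpace ℝ (Fin 2)))) : ℕ :=
  Set.ncard {u : U | (∃ p ∈ ⋃₀ F, dist p (s u) ≤ ψ) ∧ (∃ p ∈ ⋃₀ F, dist p (d u) ≤ ψ)}

/-- The Scenario-1 coverage service function on trajectories is not submodular. -/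
theorem scenario1_coverage_not_submodular :
    ∃ (ψ : ℝ), 0 < ψ ∧
    ∃ (U : Type) (_ : Fintype U) (s d : U → EuclideanSpace ℝ (Fin 2))
      (A B : Set (Set (EuclideanSpace ℝ (Fin 2)))) (x : Set (EuclideanSpace ℝ (Fin 2))),
      A ⊆ B ∧ A.Finite ∧ B.Finite ∧ x.Finite ∧ (∀ f ∈ B, f.Finite) ∧
      (SO ψ s d (B ∪ {x}) : ℤ) - (SO ψ s d B : ℤ) >
        (SO ψ s d (A ∪ {x}) : ℤ) - (SO ψ s d A : ℤ) := by
  let q : EuclideanSpace ℝ (Fin 2) := EuclideanSpace.single 0 3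
  have hq : ‖q‖ = 3 := by simp [q]
  refine ⟨1, one_pos, Unit, inferInstance, fun _ => 0, fun _ => q, ∅, {{0}}, {q},
    Set.empty_subset _, Set.finite_empty, Set.finite_singleton _, Set.finite_singleton _,
    by simp, ?_⟩
  have h_empty : SO 1 (fun _ : Unit => 0) (fun _ => q) ∅ = 0 := by simp [SO]
  have h_dest : SO 1 (fun _ : Unit => 0) (fun _ => q) (∅ ∪ {{q}}) = 0 := by
    simp [SO, hq]
  have h_source : SO 1 (fun _ : Unit => 0) (fun _ => q) {{0}} = 0 := by
    simp [SO, hq]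
  have h_both : SO 1 (fun _ : Unit => 0) (fun _ => q) ({{0}} ∪ {{q}}) = 1 := by
    simp [SO, hq]
  rw [h_empty, h_dest, h_source, h_both]
  norm_num
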